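/- Adding independent Laplace noise of scale ΔQ/ε to the answer of a query Q of ℓ¹-sensitivity ΔQ is an ε-differentially private mechanism: for neighbouring datasets D₁, D₂ with |Q(D₁) − Q(D₂)| ≤ ΔQ and any measurable set O, Pr(Q(D₁) + Lap(ΔQ/ε) ∈ O) ≤ e^ε · Pr(Q(D₂) + Lap(ΔQ/ε) ∈ O). -/

import Mathlib

/-- The Laplace mechanism with scale `ΔQ/ε` is `ε`-differentially private: for
neighbouring histograms `D₁, D₂` (ℓ¹-distance 1), a query `Q` of sensitivity
`ΔQ`, and any measurable output set `O`, the output distribution on `D₁` is at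
most `e^ε` times that on `D₂`. -/
theorem laplace_mechanism_dp {𝒟 : Type*} [Fintype 𝒟]
    (Q : (𝒟 → ℕ) → ℝ) (ΔQ ε : ℝ) (hΔ : 0 < ΔQ) (hε : 0 < ε)
    (hsens : ∀ E₁ E₂ : 𝒟 → ℕ, (∑ x, |(E₁ x : ℤ) - (E₂ x : ℤ)|) = 1 →
      |Q E₁ - Q E₂| ≤ ΔQ)
    (D₁ D₂ : 𝒟 → ℕ) (hneighbour : (∑ x, |(D₁ x : ℤ) - (D₂ x : ℤ)|) = 1)
    (O : Set ℝ) (hO : MeasurableSet O) :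
    (∫⁻ x in O, ENNReal.ofReal
        ((ε / (2 * ΔQ)) * Real.exp (-|x - Q D₁| * ε / ΔQ)))
      ≤ ENNReal.ofReal (Real.exp ε) *
        ∫⁻ x in O, ENNReal.ofReal
          ((ε / (2 * ΔQ)) * Real.exp (-|x - Q D₂| * ε / ΔQ)) := by
  rw [← MeasureTheory.lintegral_const_mul' _ _ ENNReal.ofReal_ne_top]
  refine MeasureTheory.lintegral_mono fun x => ?_
  have h := hsens D₁ D₂ hneighbour
  have htri : |x - Q D₂| ≤ |x - Q D₁| + |Q D₁ - Q D₂| := abs_sub_le _ _ _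
  rw [← ENNReal.ofReal_mul (Real.exp_pos ε).le]
  apply ENNReal.ofReal_le_ofReal
  rw [mul_left_comm, ← Real.exp_add]
  apply mul_le_mul_of_nonneg_left _ (by positivity)
  apply Real.exp_le_exp.mpr
  have e : ε + -|x - Q D₂| * ε / ΔQ = (ΔQ - |x - Q D₂|) * ε / ΔQ := by
    field_simp
    ring
  rw [e]
  apply div_le_div_of_nonneg_right _ hΔ.le
  apply mul_le_mul_of_nonneg_right _ hε.le
  linarith
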